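/- Let A be a finite abelian group, q : A → ℚ/ℤ a non-degenerate quadratic function, and L a subgroup of A on which q vanishes (an isotropic subgroup). Then L = L^⊥ if and only if |L|² = |A|, where L^⊥ = {x ∈ A | σ(x,y) = 0 for all y ∈ L} and σ is the polarisation of q. -/

import Mathlib

/-- ℚ/ℤ. -/
abbrev QZ := AddCircle (1 : ℚ)

/-- The polarisation of a function `q : A → ℚ/ℤ`. -/
def polar {A : Type*} [AddCommGroup A] (q : A → QZ) (x y : A) : QZ :=
  q (x + y) - q x - q y

/-- A quadratic function on an abelian group with values in ℚ/ℤ. -/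
def IsQuadratic {A : Type*} [AddCommGroup A] (q : A → QZ) : Prop :=
  (∀ (n : ℤ) (x : A), q (n • x) = n ^ 2 • q x) ∧
  (∀ x x' y : A, polar q (x + x') y = polar q x y + polar q x' y) ∧
  (∀ x y y' : A, polar q x (y + y') = polar q x y + polar q x y')

/-- The inclusion of `ℚ/ℤ` into the circle. -/
noncomputable def ratAddCircleToCircle : AddChar QZ Circle :=
  AddChar.toAddMonoidHomEquiv.symm <|
    (AddCircle.toCircle_addChar (T := (1 : ℝ))).toAddMonoidHom.comp <|
      QuotientAddGroup.map _ (AddSubgroup.zmultiples (1 : ℝ)) (Rat.castHom ℝ).toAddMonoidHom <| by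
        rw [AddSubgroup.zmultiples_le]
        exact AddSubgroup.mem_zmultiples_iff.2 ⟨1, by simp⟩

theorem eq_zero_of_ratAddCircleToCircle_eq_one {x : QZ} (hx : ratAddCircleToCircle x = 1) :
    x = 0 := by
  induction x using QuotientAddGroup.induction_on with
  | H r =>
    have h : AddCircle.toCircle ((r : ℝ) : AddCircle (1 : ℝ)) =
        AddCircle.toCircle (0 : AddCircle (1 : ℝ)) := by
      rw [AddCircle.toCircle_zero]
      exact hx
    obtain ⟨n, hn⟩ := (AddCircle.coe_eq_zero_iff (1 : ℝ)).1
      (AddCircle.injective_toCircle one_ne_zero h)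
    refine (AddCircle.coe_eq_zero_iff (1 : ℚ)).2 ⟨n, ?_⟩
    have h' : ((n • (1 : ℚ) : ℚ) : ℝ) = r := by simpa using hn
    exact_mod_cast h'

theorem ratAddCircleToCircle_injective : Function.Injective ratAddCircleToCircle := by
  intro x y hxy
  rw [← sub_eq_zero]
  apply eq_zero_of_ratAddCircleToCircle_eq_one
  rw [AddChar.map_sub_eq_div, hxy, div_self']

/-- The complex character attached to a homomorphism into `ℚ/ℤ`. -/
noncomputable def AddMonoidHom.toComplexAddChar {G : Type*} [AddCommGroup G] (f : G →+ QZ) :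
    AddChar G ℂ :=
  Circle.coeHom.compAddChar (ratAddCircleToCircle.compAddMonoidHom f)

theorem AddMonoidHom.toComplexAddChar_injective {G : Type*} [AddCommGroup G] :
    Function.Injective (AddMonoidHom.toComplexAddChar (G := G)) := by
  intro f g hfg
  ext x
  apply ratAddCircleToCircle_injective
  exact Circle.coe_injective (DFunLike.congr_fun hfg x)

instance finite_addMonoidHom_ratAddCircle {G : Type*} [AddCommGroup G] [Finite G] :
    Finite (G →+ QZ) :=
  Finite.of_injective _ AddMonoidHom.toComplexAddChar_injective

theorem card_addMonoidHom_ratAddCircle_le (G : Type*) [AddCommGroup G] [Finite G] :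
    Nat.card (G →+ QZ) ≤ Nat.card G := by
  cases nonempty_fintype G
  calc Nat.card (G →+ QZ) ≤ Nat.card (AddChar G ℂ) :=
        Nat.card_le_card_of_injective _ AddMonoidHom.toComplexAddChar_injective
    _ = Nat.card G := by
        rw [Nat.card_eq_fintype_card, Nat.card_eq_fintype_card, AddChar.card_eq]

/-- For a pairing `B : G × H → ℚ/ℤ` of finite abelian groups, the left kernel of `B` has index at
most the order of `H`. -/
theorem card_le_card_ker_mul_card {G H : Type*} [AddCommGroup G] [AddCommGroup H]
    [Finite G] [Finite H] (B : G →+ H →+ QZ) :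
    Nat.card G ≤ Nat.card B.ker * Nat.card H := by
  rw [B.ker.card_eq_card_quotient_mul_card_addSubgroup, mul_comm]
  gcongr
  exact (Nat.card_le_card_of_injective _ (QuotientAddGroup.kerLift_injective B)).trans
    (card_addMonoidHom_ratAddCircle_le H)

/-- A subgroup and its orthogonal complement under a non-degenerate pairing have complementary
orders. -/
theorem card_mul_card_ker_domRestrict {G : Type*} [AddCommGroup G] [Finite G]
    (B : G →+ G →+ QZ) (hB : ∀ x, (∀ y, B y x = 0) → x = 0) (L : AddSubgroup G) :
    Nat.card L * Nat.card ((AddMonoidHom.compHom' L.subtype).comp B).ker = Nat.card G := by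
  set K := ((AddMonoidHom.compHom' L.subtype).comp B).ker with hK
  apply le_antisymm
  · let C : L →+ (G ⧸ K) →+ QZ :=
      (QuotientAddGroup.kerLift ((AddMonoidHom.compHom' L.subtype).comp B)).flip
    have hC : Function.Injective C := by
      rw [injective_iff_map_eq_zero]
      intro x hx
      refine Subtype.ext (hB x fun y => ?_)
      exact DFunLike.congr_fun hx (y : G ⧸ K)
    rw [K.card_eq_card_quotient_mul_card_addSubgroup]
    gcongr
    exact (Nat.card_le_card_of_injective _ hC).trans (card_addMonoidHom_ratAddCircle_le _)
  · rw [mul_comm]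
    exact card_le_card_ker_mul_card _

theorem polar_symm {A : Type*} [AddCommGroup A] (q : A → QZ) (x y : A) :
    polar q x y = polar q y x := by
  simp only [polar, add_comm x y, sub_right_comm]

/-- The polarisation of a quadratic function as a biadditive map. -/
def IsQuadratic.polarHom {A : Type*} [AddCommGroup A] {q : A → QZ} (hq : IsQuadratic q) :
    A →+ A →+ QZ :=
  AddMonoidHom.mk' (fun x => AddMonoidHom.mk' (polar q x) (hq.2.2 x)) fun x x' =>
    AddMonoidHom.ext (hq.2.1 x x')

theorem lagrangian_iff_card_sq {A : Type*} [AddCommGroup A] [Finite A]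
    (q : A → QZ) (hq : IsQuadratic q)
    (hnd : ∀ x : A, (∀ y : A, polar q x y = 0) → x = 0)
    (L : AddSubgroup A) (hiso : ∀ x ∈ L, q x = 0) :
    (L : Set A) = {x : A | ∀ y ∈ L, polar q x y = 0} ↔
      Nat.card L ^ 2 = Nat.card A := by
  have hcard := card_mul_card_ker_domRestrict hq.polarHom
    (fun x hx => hnd x fun y => (polar_symm q x y).trans (hx y)) L
  set K := ((AddMonoidHom.compHom' L.subtype).comp hq.polarHom).ker
  have hK : {x : A | ∀ y ∈ L, polar q x y = 0} = (K : Set A) := by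
    ext x
    exact ⟨fun h => AddMonoidHom.ext fun y => h y y.2,
      fun h y hy => DFunLike.congr_fun h (⟨y, hy⟩ : L)⟩
  have hLK : L ≤ K := by
    rw [← SetLike.coe_subset_coe, ← hK]
    intro x hx y hy
    simp [polar, hiso _ (L.add_mem hx hy), hiso x hx, hiso y hy]
  rw [hK, SetLike.coe_set_eq]
  constructor
  · intro h
    rw [← hcard, ← h, sq]
  · intro h
    rw [← hcard, sq] at h
    exact AddSubgroup.eq_of_le_of_card_ge hLK (Nat.eq_of_mul_eq_mul_left Nat.card_pos h).ge
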